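/- Let Γ be a set and let K ⊆ Σ(Γ) be a solid compact subset (with the product topology of ℝ^Γ). Then the following are equivalent: (i) K is weakly Radon–Nikodým; (ii) K is quasi weakly Radon–Nikodým; (iii) K is Eberlein compact. -/

import Mathlib

open Set Function

/-- A sequence of pairs of subsets `(A n, B n)` of a set `S` is *independent* if for every
`n` and every choice function `ε`, the intersection over `k < n` of `A k` (if `ε k = 0/false`)
or `B k` (if `ε k = 1/true`) is nonempty. -/
def IsIndependentSeq {S : Type*} (A B : ℕ → Set S) : Prop :=
  ∀ (n : ℕ) (ε : Fin n → Bool),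
    (⋂ k : Fin n, if ε k = true then B (k : ℕ) else A (k : ℕ)).Nonempty

/-- A real Banach space `X` *contains an isomorphic copy of `ℓ¹`* if there is a bounded
linear map from `ℓ¹` into `X` which is an isomorphism onto its image, i.e. bounded below. -/
def ContainsL1 (X : Type*) [NormedAddCommGroup X] [NormedSpace ℝ X] : Prop :=
  ∃ T : lp (fun _ : ℕ => ℝ) 1 →L[ℝ] X, ∃ c : ℝ, 0 < c ∧ ∀ v, c * ‖v‖ ≤ ‖T v‖

/-- A compact (Hausdorff) space is *weakly Radon–Nikodým* if it is homeomorphic to a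
weak*-compact subset of the dual of a real Banach space not containing a copy of `ℓ¹`. -/
def IsWRN (K : Type*) [TopologicalSpace K] : Prop :=
  ∃ (X : Type) (_ : NormedAddCommGroup X) (_ : NormedSpace ℝ X) (_ : CompleteSpace X)
    (S : Set (WeakDual ℝ X)), ¬ ContainsL1 X ∧ IsCompact S ∧ Nonempty (K ≃ₜ S)

/-- A compact space `K` is *quasi weakly Radon–Nikodým* (QWRN) if there is a homeomorphic
embedding `i` of `K` into `[0,1]^Γ` for some set `Γ` such that for every `ε > 0` there is a
countable decomposition `Γ = ⋃ n, Γs n` such that for every `n` and all reals `p < q` with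
`q - p > ε`, the family of pairs `({x | (i x α : ℝ) < p}, {x | (i x α : ℝ) > q})`, `α ∈ Γs n`,
contains no independent sequence. -/
def IsQWRN (K : Type*) [TopologicalSpace K] : Prop :=
  ∃ (Γ : Type) (i : K → Γ → unitInterval), Topology.IsEmbedding i ∧
    ∀ ε : ℝ, ε > 0 → ∃ Γs : ℕ → Set Γ, (⋃ n, Γs n) = Set.univ ∧
      ∀ n : ℕ, ∀ p q : ℝ, q - p > ε →
        ¬ ∃ φ : ℕ → Γ, (∀ m, φ m ∈ Γs n) ∧
          IsIndependentSeq (fun m => {x : K | (i x (φ m) : ℝ) < p})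
                           (fun m => {x : K | (i x (φ m) : ℝ) > q})

/-- A compact space is *Eberlein* if it is homeomorphic to a weakly compact subset of a
real Banach space equipped with its weak topology. -/
def IsEberlein (K : Type*) [TopologicalSpace K] : Prop :=
  ∃ (X : Type) (_ : NormedAddCommGroup X) (_ : NormedSpace ℝ X) (_ : CompleteSpace X)
    (S : Set (WeakSpace ℝ X)), IsCompact S ∧ Nonempty (K ≃ₜ S)


theorem IsIndependentSeq.exists_forall_lt {S : Type*} {A B : ℕ → Set S}
    (h : IsIndependentSeq A B) (n : ℕ) (P : ℕ → Prop) :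
    ∃ x, ∀ k < n, (P k → x ∈ B k) ∧ (¬ P k → x ∈ A k) := by
  classical
  obtain ⟨x, hx⟩ := h n (fun k => decide (P k))
  refine ⟨x, fun k hk => ?_⟩
  have := Set.mem_iInter.1 hx ⟨k, hk⟩
  by_cases hP : P k <;> simpa [hP] using this

/-- A uniformly bounded point-separating family of continuous functions without independent
sequences witnesses that a compact space is quasi weakly Radon–Nikodým. -/
theorem isQWRN_of_separating {K : Type*} [TopologicalSpace K] [CompactSpace K] {Γ : Type}
    (g : Γ → K → ℝ) (hg : ∀ γ, Continuous (g γ)) {C : ℝ} (hC : ∀ γ x, |g γ x| ≤ C)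
    (hsep : ∀ x y, (∀ γ, g γ x = g γ y) → x = y)
    (hind : ∀ p q, p < q → ∀ φ : ℕ → Γ,
      ¬ IsIndependentSeq (fun m => {x | g (φ m) x < p}) (fun m => {x | g (φ m) x > q})) :
    IsQWRN K := by
  have hD : 0 < |C| + 1 := by positivity
  set D := |C| + 1 with hDdef
  have hb : ∀ γ x, (1 + g γ x / D) / 2 ∈ unitInterval := by
    intro γ x
    have h1 : |g γ x| ≤ D := (hC γ x).trans ((le_abs_self C).trans (by linarith))
    obtain ⟨h2, h3⟩ := abs_le.1 h1
    have h4 : g γ x / D ≤ 1 := (div_le_one hD).2 h3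
    have h5 : -1 ≤ g γ x / D := by rw [le_div_iff₀ hD]; linarith
    constructor <;> linarith
  refine ⟨Γ, fun x γ => ⟨_, hb γ x⟩, ?_, ?_⟩
  · refine (Continuous.isClosedEmbedding ?_ ?_).isEmbedding
    · refine continuous_pi fun γ => Continuous.subtype_mk ?_ _
      have := hg γ
      fun_prop
    · intro x y hxy
      refine hsep x y fun γ => ?_
      have h1 := congrArg Subtype.val (congrFun hxy γ)
      simp only at h1
      have h2 : g γ x / D = g γ y / D := by linarith
      exact (div_left_inj' hD.ne').1 h2
  · intro ε hε
    refine ⟨fun _ => univ, iUnion_const _, fun _ p q hpq => ?_⟩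
    rintro ⟨φ, -, hφ⟩
    have hlt : ∀ γ x t, (1 + g γ x / D) / 2 < t ↔ g γ x < (2 * t - 1) * D := by
      intro γ x t
      rw [← div_lt_iff₀ hD]
      constructor <;> intro <;> linarith
    have hgt : ∀ γ x t, (1 + g γ x / D) / 2 > t ↔ g γ x > (2 * t - 1) * D := by
      intro γ x t
      rw [gt_iff_lt, gt_iff_lt, ← lt_div_iff₀ hD]
      constructor <;> intro <;> linarith
    simp only [hlt, hgt] at hφ
    exact hind _ _ (mul_lt_mul_of_pos_right (by linarith) hD) φ hφ

/-- If the bounded sequence `x` dominates the `ℓ¹` basis, the ambient space contains `ℓ¹`. -/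
theorem containsL1_of_lower_estimate {X : Type*} [NormedAddCommGroup X] [NormedSpace ℝ X]
    [CompleteSpace X] (x : ℕ → X) (hx : ∀ n, ‖x n‖ ≤ 1) {c : ℝ} (hc : 0 < c)
    (h : ∀ (n : ℕ) (a : ℕ → ℝ),
      c * ∑ k ∈ Finset.range n, |a k| ≤ ‖∑ k ∈ Finset.range n, a k • x k‖) :
    ContainsL1 X := by
  have hnorm : ∀ v : lp (fun _ : ℕ => ℝ) 1, HasSum (fun n => |v n|) ‖v‖ := by
    intro v
    simpa using lp.hasSum_norm (p := 1) (by simp) v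
  have hle : ∀ (v : lp (fun _ : ℕ => ℝ) 1) n, ‖v n • x n‖ ≤ |v n| := by
    intro v n
    rw [norm_smul, Real.norm_eq_abs]
    exact mul_le_of_le_one_right (abs_nonneg _) (hx n)
  have hsum : ∀ v : lp (fun _ : ℕ => ℝ) 1, Summable fun n => v n • x n := fun v =>
    Summable.of_norm_bounded (hnorm v).summable (hle v)
  let T : lp (fun _ : ℕ => ℝ) 1 →ₗ[ℝ] X :=
    { toFun := fun v => ∑' n, v n • x n
      map_add' := fun v w => by
        rw [← (hsum v).tsum_add (hsum w)]
        exact tsum_congr fun n => by simp [add_smul]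
      map_smul' := fun r v => by
        simp only [RingHom.id_apply]
        rw [← (hsum v).tsum_const_smul]
        exact tsum_congr fun n => by simp [mul_smul] }
  refine ⟨T.mkContinuous 1 fun v => ?_, c, hc, fun v => ?_⟩
  · rw [one_mul]
    exact tsum_of_norm_bounded (hnorm v) (hle v)
  · have h1 := (hnorm v).tendsto_sum_nat.const_mul c
    have h2 := (hsum v).hasSum.tendsto_sum_nat.norm
    exact le_of_tendsto_of_tendsto' h1 h2 fun n => h n v

theorem IsWRN.isQWRN {K : Type*} [TopologicalSpace K] (h : IsWRN K) : IsQWRN K := by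
  obtain ⟨X, _, _, _, S, hX, hS, ⟨e⟩⟩ := h
  have : CompactSpace S := isCompact_iff_compactSpace.1 hS
  have : CompactSpace K := e.symm.compactSpace
  obtain ⟨C, hC⟩ : ∃ C, ∀ s : S, ‖WeakDual.toStrongDual s.1‖ ≤ C := by
    refine banach_steinhaus fun x => ?_
    obtain ⟨C, hC⟩ := (hS.image (WeakDual.eval_continuous x)).isBounded.exists_norm_le
    exact ⟨C, fun s => hC _ ⟨s, s.2, rfl⟩⟩
  have hCx : ∀ (s : S) (x : X), |s.1 x| ≤ C * ‖x‖ := fun s x =>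
    ((WeakDual.toStrongDual s.1).le_opNorm x).trans
      (mul_le_mul_of_nonneg_right (hC s) (norm_nonneg x))
  refine isQWRN_of_separating (Γ := Metric.closedBall (0 : X) 1) (fun x k => (e k).1 x.1)
    (fun x => (WeakDual.eval_continuous x.1).comp (continuous_subtype_val.comp e.continuous))
    (C := |C|) ?_ ?_ ?_
  · intro x k
    have hx : ‖x.1‖ ≤ 1 := mem_closedBall_zero_iff.1 x.2
    refine (hCx _ _).trans ?_
    calc C * ‖x.1‖ ≤ |C| * ‖x.1‖ := by gcongr; exact le_abs_self C
      _ ≤ |C| * 1 := by gcongr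
      _ = |C| := mul_one _
  · intro k l hkl
    refine e.injective (Subtype.ext (DFunLike.ext _ _ fun x => ?_))
    have hd : 0 < ‖x‖ + 1 := by positivity
    have := hkl ⟨(‖x‖ + 1)⁻¹ • x, by
      rw [mem_closedBall_zero_iff, norm_smul, norm_inv, Real.norm_of_nonneg hd.le,
        inv_mul_le_iff₀ hd]
      linarith⟩
    simp only [map_smul, smul_eq_mul] at this
    exact mul_left_cancel₀ (inv_ne_zero hd.ne') this
  · intro p q hpq φ hφ
    refine hX (containsL1_of_lower_estimate (fun n => (φ n).1)
      (fun n => mem_closedBall_zero_iff.1 (φ n).2) (c := (q - p) / (2 * (|C| + 1)))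
      (div_pos (by linarith) (by positivity)) fun n a => ?_)
    set u := ∑ k ∈ Finset.range n, a k • (φ k).1 with hu
    obtain ⟨s, hs⟩ := hφ.exists_forall_lt n (fun k => 0 ≤ a k)
    obtain ⟨t, ht⟩ := hφ.exists_forall_lt n (fun k => a k < 0)
    simp only [mem_ofPred_eq, not_lt, not_le] at hs ht
    have hlow : (q - p) * ∑ k ∈ Finset.range n, |a k| ≤ (e s).1 u - (e t).1 u := by
      rw [hu, map_sum, map_sum, ← Finset.sum_sub_distrib, Finset.mul_sum]
      refine Finset.sum_le_sum fun k hk => ?_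
      have hk' := Finset.mem_range.1 hk
      simp only [map_smul, smul_eq_mul]
      rcases le_or_gt 0 (a k) with h0 | h0
      · have h1 := (hs k hk').1 h0
        have h2 := (ht k hk').2 h0
        rw [abs_of_nonneg h0]
        nlinarith
      · have h1 := (hs k hk').2 h0
        have h2 := (ht k hk').1 h0
        rw [abs_of_neg h0]
        nlinarith
    have hup : (e s).1 u - (e t).1 u ≤ 2 * (|C| + 1) * ‖u‖ := by
      have h1 := (abs_le.1 (hCx (e s) u)).2
      have h2 := (abs_le.1 (hCx (e t) u)).1
      have h3 : C * ‖u‖ ≤ (|C| + 1) * ‖u‖ := by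
        gcongr; linarith [le_abs_self C]
      linarith
    rw [div_mul_eq_mul_div, div_le_iff₀ (by positivity)]
    linarith

/-- Separately continuous functions on a product of compact spaces admit no independent
sequences (a double limit argument). -/
theorem not_isIndependentSeq_of_separatelyContinuous {K Y : Type*} [TopologicalSpace K]
    [CompactSpace K] [TopologicalSpace Y] [CompactSpace Y] (g : Y → K → ℝ)
    (hg : ∀ y, Continuous (g y)) (hg' : ∀ x, Continuous fun y => g y x) {p q : ℝ} (hpq : p < q)
    (φ : ℕ → Y) :
    ¬ IsIndependentSeq (fun m => {x | g (φ m) x < p}) (fun m => {x | g (φ m) x > q}) := by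
  intro h
  let U : Ultrafilter ℕ := Filter.hyperfilter ℕ
  have hU : ∀ n : ℕ, ∀ᶠ m in (U : Filter ℕ), n < m := fun n =>
    (Nat.hyperfilter_le_atTop) (Filter.eventually_gt_atTop n)
  have hlimK : ∀ u : ℕ → K, ∃ x, Filter.Tendsto u U (nhds x) := fun u =>
    ⟨(U.map u).lim, by
      rw [Filter.Tendsto, ← Ultrafilter.coe_map]; exact Ultrafilter.le_nhds_lim _⟩
  have hlimY : ∃ y, Filter.Tendsto φ U (nhds y) :=
    ⟨(U.map φ).lim, by
      rw [Filter.Tendsto, ← Ultrafilter.coe_map]; exact Ultrafilter.le_nhds_lim _⟩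
  have hx : ∀ k : ℕ, ∃ x, (∀ j, j ≤ k → g (φ j) x ≤ p) ∧ ∀ j, k < j → q ≤ g (φ j) x := by
    intro k
    choose u hu using fun n => h.exists_forall_lt n (fun j => k < j)
    obtain ⟨x, hx⟩ := hlimK u
    refine ⟨x, fun j hj => ?_, fun j hj => ?_⟩
    · refine le_of_tendsto (((hg (φ j)).tendsto x).comp hx) ?_
      filter_upwards [hU j] with n hn
      exact le_of_lt ((hu n j hn).2 (not_lt.2 hj))
    · refine ge_of_tendsto (((hg (φ j)).tendsto x).comp hx) ?_
      filter_upwards [hU j] with n hn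
      exact le_of_lt ((hu n j hn).1 hj)
  choose u hu1 hu2 using hx
  obtain ⟨x, hx⟩ := hlimK u
  obtain ⟨y, hy⟩ := hlimY
  have h1 : g y x ≤ p := by
    refine le_of_tendsto (((hg' x).tendsto y).comp hy) (Filter.Eventually.of_forall fun j => ?_)
    refine le_of_tendsto (((hg (φ j)).tendsto x).comp hx) ?_
    filter_upwards [hU j] with k hk
    exact hu1 k j hk.le
  have h2 : q ≤ g y x := by
    refine ge_of_tendsto (((hg y).tendsto x).comp hx) (Filter.Eventually.of_forall fun k => ?_)
    refine ge_of_tendsto (((hg' (u k)).tendsto y).comp hy) ?_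
    filter_upwards [hU k] with j hj
    exact hu2 k j hj
  linarith

theorem IsEberlein.isQWRN {K : Type*} [TopologicalSpace K] (h : IsEberlein K) : IsQWRN K := by
  obtain ⟨X, _, _, _, S, hS, ⟨e⟩⟩ := h
  have : CompactSpace S := isCompact_iff_compactSpace.1 hS
  have : CompactSpace K := e.symm.compactSpace
  have hev : ∀ f : StrongDual ℝ X,
      Continuous fun x : WeakSpace ℝ X => f ((toWeakSpace ℝ X).symm x) := fun f =>
    WeakBilin.eval_continuous (topDualPairing ℝ X).flip f
  obtain ⟨C, hC⟩ : ∃ C, ∀ s : S,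
      ‖NormedSpace.inclusionInDoubleDual ℝ X ((toWeakSpace ℝ X).symm s.1)‖ ≤ C := by
    refine banach_steinhaus fun f => ?_
    obtain ⟨C, hC⟩ := (hS.image (hev f)).isBounded.exists_norm_le
    exact ⟨C, fun s => hC _ ⟨s, s.2, rfl⟩⟩
  let B : Set (WeakDual ℝ X) := WeakDual.toStrongDual ⁻¹' Metric.closedBall 0 1
  have : CompactSpace B := isCompact_iff_compactSpace.1 (WeakDual.isCompact_closedBall _ _)
  have hB : ∀ f : B, ‖WeakDual.toStrongDual f.1‖ ≤ 1 := fun f => mem_closedBall_zero_iff.1 f.2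
  let g : B → K → ℝ := fun f k => f.1 ((toWeakSpace ℝ X).symm (e k).1)
  have hg : ∀ f, Continuous (g f) := fun f =>
    (hev (WeakDual.toStrongDual f.1)).comp (continuous_subtype_val.comp e.continuous)
  refine isQWRN_of_separating g hg (C := C) ?_ ?_ fun p q hpq φ =>
    not_isIndependentSeq_of_separatelyContinuous g hg
      (fun x => (WeakDual.eval_continuous _).comp continuous_subtype_val) hpq φ
  · intro f k
    refine le_trans ?_ (hC (e k))
    refine ((NormedSpace.inclusionInDoubleDual ℝ X ((toWeakSpace ℝ X).symm (e k).1)).le_opNorm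
      (WeakDual.toStrongDual f.1)).trans ?_
    exact mul_le_of_le_one_right (norm_nonneg _) (hB f)
  · intro k l hkl
    refine e.injective (Subtype.ext ((toWeakSpace ℝ X).symm.injective ?_))
    refine (SeparatingDual.eq_iff_forall_dual_eq (R := ℝ)).2 fun f => ?_
    have hd : 0 < ‖f‖ + 1 := by positivity
    have := hkl ⟨StrongDual.toWeakDual ((‖f‖ + 1)⁻¹ • f), by
      change (‖f‖ + 1)⁻¹ • f ∈ Metric.closedBall 0 1
      rw [mem_closedBall_zero_iff, norm_smul, norm_inv, Real.norm_of_nonneg hd.le,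
        inv_mul_le_iff₀ hd]
      linarith⟩
    exact mul_left_cancel₀ (inv_ne_zero hd.ne') this

/-- For a finite colouring of the nodes of the binary tree (pairs `(a, F)` with `F ⊆ [0, a)`),
some colour is dense above some node `(n₀, F₀)`, along levels converging to an ultrafilter. -/
theorem exists_dense_color {κ : Type*} [Finite κ] (c : ℕ → Finset ℕ → κ) :
    ∃ (n₀ : ℕ) (F₀ : Finset ℕ) (j : κ), F₀ ⊆ Finset.range n₀ ∧
      ∀ (n : ℕ) (F : Finset ℕ), n₀ ≤ n → F ⊆ Finset.range n → F.filter (· < n₀) = F₀ →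
        ∀ᶠ a in (Filter.hyperfilter ℕ : Filter ℕ),
          ∃ F' ⊆ Finset.range a, F'.filter (· < n) = F ∧ c a F' = j := by
  classical
  let see : ℕ × Finset ℕ → Set κ := fun t => {j | ∀ᶠ a in (Filter.hyperfilter ℕ : Filter ℕ),
    ∃ F' ⊆ Finset.range a, F'.filter (· < t.1) = t.2 ∧ c a F' = j}
  let N : Set (ℕ × Finset ℕ) := {t | t.2 ⊆ Finset.range t.1}
  have hne : ∀ t ∈ N, (see t).Nonempty := by
    rintro ⟨n, F⟩ hF
    have h1 : ∀ᶠ a in (Filter.hyperfilter ℕ : Filter ℕ), n ≤ a :=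
      Nat.hyperfilter_le_atTop (Filter.eventually_ge_atTop n)
    have h2 : (⋃ j ∈ (univ : Set κ), {a | ∃ F' ⊆ Finset.range a,
        F'.filter (· < n) = F ∧ c a F' = j}) ∈ Filter.hyperfilter ℕ := by
      filter_upwards [h1] with a ha
      simp only [mem_univ, iUnion_true, mem_iUnion]
      refine ⟨c a F, F, hF.trans (Finset.range_mono ha), ?_, rfl⟩
      exact Finset.filter_true_of_mem fun x hx => Finset.mem_range.1 (hF hx)
    obtain ⟨j, -, hj⟩ := (Ultrafilter.finite_biUnion_mem_iff finite_univ).1 h2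
    exact ⟨j, hj⟩
  have hN : N.Nonempty := ⟨(0, ∅), by simp [N]⟩
  let t := Function.argminOn (fun t => (see t).ncard) N hN
  have htN : t ∈ N := Function.argminOn_mem _ _ _
  have htmin : ∀ u ∈ N, (see t).ncard ≤ (see u).ncard := fun u hu =>
    Function.argminOn_le (fun t => (see t).ncard) N hu
  obtain ⟨j, hj⟩ := hne t htN
  refine ⟨t.1, t.2, j, htN, fun n F hn hF hFt => ?_⟩
  have hsub : see (n, F) ⊆ see t := by
    intro i hi
    filter_upwards [hi] with a ha
    obtain ⟨F', h1, h2, h3⟩ := ha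
    refine ⟨F', h1, ?_, h3⟩
    rw [← hFt, ← h2, Finset.filter_filter]
    refine Finset.filter_congr fun x _ => ?_
    constructor
    · intro hx; exact ⟨lt_of_lt_of_le hx hn, hx⟩
    · exact fun hx => hx.2
  have heq : see (n, F) = see t := Set.eq_of_subset_of_ncard_le hsub (htmin _ hF) (toFinite _)
  have : j ∈ see (n, F) := heq ▸ hj
  exact this

/-- A finite colouring of the nodes of the binary tree is constant on a strongly embedded subtree,
whose branches moreover avoid the prescribed gaps `(k i, N (k i))`. -/
theorem exists_monochromatic_subtree {κ : Type*} [Finite κ] (c : ℕ → Finset ℕ → κ) (N : ℕ → ℕ) :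
    ∃ (j : κ) (k : ℕ → ℕ), ∀ (n : ℕ) (P : ℕ → Prop), ∃ G : Finset ℕ, ∀ i < n,
      c (k i) (G.filter (· < k i)) = j ∧ (k i ∈ G ↔ P i) ∧ ∀ m ∈ G, k i < m → N (k i) ≤ m := by
  classical
  obtain ⟨n₀, F₀, j, hF₀, hd⟩ := exists_dense_color c
  -- the least admissible continuation level above `a`
  let b : ℕ → ℕ := fun a => max (N a) (a + 1)
  have hstep : ∀ a, n₀ ≤ a → ∃ a', b a ≤ a' ∧ ∀ F ⊆ Finset.range (a + 1),
      F.filter (· < n₀) = F₀ → ∃ F' ⊆ Finset.range a', F'.filter (· < b a) = F ∧ c a' F' = j := by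
    intro a ha
    have h1 : ∀ᶠ a' in (Filter.hyperfilter ℕ : Filter ℕ), b a ≤ a' :=
      Nat.hyperfilter_le_atTop (Filter.eventually_ge_atTop _)
    have h2 : ∀ᶠ a' in (Filter.hyperfilter ℕ : Filter ℕ),
        ∀ F ∈ (Finset.range (a + 1)).powerset, F.filter (· < n₀) = F₀ →
          ∃ F' ⊆ Finset.range a', F'.filter (· < b a) = F ∧ c a' F' = j := by
      rw [Filter.eventually_all_finset]
      intro F hF
      by_cases hFF : F.filter (· < n₀) = F₀
      · have hlt : a + 1 ≤ b a := le_max_right _ _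
        filter_upwards [hd (b a) F (by omega)
          ((Finset.mem_powerset.1 hF).trans (Finset.range_mono hlt)) hFF] with a' ha' _
        exact ha'
      · exact Filter.Eventually.of_forall fun _ h => absurd h hFF
    obtain ⟨a', h3, h4⟩ := (h1.and h2).exists
    exact ⟨a', h3, fun F hF => h4 F (Finset.mem_powerset.2 hF)⟩
  obtain ⟨a₀, ha₀, F₁, hF₁, hF₁', hc₁⟩ : ∃ a₀, n₀ ≤ a₀ ∧ ∃ F' ⊆ Finset.range a₀,
      F'.filter (· < n₀) = F₀ ∧ c a₀ F' = j := by
    have h1 : ∀ᶠ a' in (Filter.hyperfilter ℕ : Filter ℕ), n₀ ≤ a' :=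
      Nat.hyperfilter_le_atTop (Filter.eventually_ge_atTop _)
    have h2 := hd n₀ F₀ le_rfl hF₀
      (Finset.filter_true_of_mem fun x hx => Finset.mem_range.1 (hF₀ hx))
    exact (h1.and h2).exists
  choose! s hs1 hs2 using hstep
  let k : ℕ → ℕ := fun i => s^[i] a₀
  have hksucc : ∀ i, k (i + 1) = s (k i) := fun i => Function.iterate_succ_apply' s i a₀
  have hk0 : ∀ i, n₀ ≤ k i := by
    intro i
    induction i with
    | zero => exact ha₀
    | succ i ih =>
      rw [hksucc]
      have := hs1 (k i) ih
      have : k i + 1 ≤ b (k i) := le_max_right _ _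
      omega
  have hkb : ∀ i, b (k i) ≤ k (i + 1) := fun i => hksucc i ▸ hs1 (k i) (hk0 i)
  have hkmono : StrictMono k := strictMono_nat_of_lt_succ fun i => by
    have := hkb i
    have : k i + 1 ≤ b (k i) := le_max_right _ _
    omega
  refine ⟨j, k, fun n P => ?_⟩
  suffices H : ∃ G ⊆ Finset.range (k n), G.filter (· < n₀) = F₀ ∧ c (k n) G = j ∧ ∀ i < n,
      c (k i) (G.filter (· < k i)) = j ∧ (k i ∈ G ↔ P i) ∧ ∀ m ∈ G, k i < m → N (k i) ≤ m by
    obtain ⟨G, -, -, -, hG⟩ := H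
    exact ⟨G, hG⟩
  induction n with
  | zero => exact ⟨F₁, hF₁, hF₁', hc₁, by simp⟩
  | succ n ih =>
    obtain ⟨G, hGk, hG0, hGc, hG⟩ := ih
    let G₁ : Finset ℕ := if P n then insert (k n) G else G
    have hmem : ∀ m, m ∈ G₁ ↔ m ∈ G ∨ (m = k n ∧ P n) := by
      intro m
      by_cases hP : P n <;> simp [G₁, hP, or_comm]
    have hG₁ : G₁ ⊆ Finset.range (k n + 1) := by
      intro m hm
      rw [Finset.mem_range]
      rcases (hmem m).1 hm with h | ⟨rfl, -⟩
      · have := Finset.mem_range.1 (hGk h); omega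
      · omega
    have hlt : ∀ a ≤ k n, G₁.filter (· < a) = G.filter (· < a) := by
      intro a ha
      ext m
      simp only [Finset.mem_filter, hmem]
      constructor
      · rintro ⟨h | ⟨rfl, -⟩, h'⟩
        · exact ⟨h, h'⟩
        · omega
      · rintro ⟨h, h'⟩; exact ⟨Or.inl h, h'⟩
    obtain ⟨F', hF'1, hF'2, hF'3⟩ := hs2 (k n) (hk0 n) G₁ hG₁ (by rw [hlt _ (hk0 n), hG0])
    rw [← hksucc] at hF'1 hF'3
    have hb : ∀ i ≤ n, k i < b (k n) := by
      intro i hi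
      have h1 := hkmono.monotone hi
      have : k n + 1 ≤ b (k n) := le_max_right _ _
      omega
    have hF'mem : ∀ m < b (k n), (m ∈ F' ↔ m ∈ G₁) := by
      intro m hm
      rw [← hF'2, Finset.mem_filter]
      exact ⟨fun h => ⟨h, hm⟩, fun h => h.1⟩
    have hfil : ∀ a ≤ k n, F'.filter (· < a) = G.filter (· < a) := by
      intro a ha
      rw [← hlt a ha]
      ext m
      simp only [Finset.mem_filter]
      have := hb n le_rfl
      constructor <;> rintro ⟨h, h'⟩ <;> refine ⟨?_, h'⟩
      · exact (hF'mem m (by omega)).1 h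
      · exact (hF'mem m (by omega)).2 h
    refine ⟨F', hF'1, by rw [hfil _ (hk0 n), hG0], hF'3, fun i hi => ?_⟩
    rcases Nat.lt_succ_iff_lt_or_eq.1 hi with hi | rfl
    · obtain ⟨h1, h2, h3⟩ := hG i hi
      have hki := hkmono hi
      refine ⟨by rw [hfil _ hki.le, h1], ?_, fun m hm hkm => ?_⟩
      · rw [hF'mem _ (hb i hi.le), hmem, h2]
        constructor
        · rintro (h | ⟨h, -⟩)
          · exact h
          · omega
        · exact Or.inl
      · rcases lt_or_ge m (b (k n)) with hmb | hmb
        · rcases (hmem m).1 ((hF'mem m hmb).1 hm) with h | ⟨rfl, -⟩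
          · exact h3 m h hkm
          · have h4 : b (k i) ≤ k (i + 1) := hkb i
            have h5 : k (i + 1) ≤ k n := hkmono.monotone hi
            have h6 : N (k i) ≤ b (k i) := le_max_left _ _
            omega
        · have h4 : b (k i) ≤ k (i + 1) := hkb i
          have h5 : k (i + 1) ≤ k n := hkmono.monotone hi
          have h6 : N (k i) ≤ b (k i) := le_max_left _ _
          have := hb n le_rfl
          omega
    · refine ⟨?_, ?_, fun m hm hkm => ?_⟩
      · rw [hfil _ le_rfl, Finset.filter_true_of_mem fun x hx => Finset.mem_range.1 (hGk hx), hGc]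
      · rw [hF'mem _ (hb i le_rfl), hmem]
        constructor
        · rintro (h | ⟨-, h⟩)
          · exact absurd (Finset.mem_range.1 (hGk h)) (lt_irrefl _)
          · exact h
        · exact fun h => Or.inr ⟨rfl, h⟩
      · rcases lt_or_ge m (b (k i)) with hmb | hmb
        · rcases (hmem m).1 ((hF'mem m hmb).1 hm) with h | ⟨rfl, -⟩
          · have := Finset.mem_range.1 (hGk h); omega
          · omega
        · exact (le_max_left _ _).trans hmb

theorem isIndependentSeq_of_exists {S : Type*} {A B : ℕ → Set S}
    (h : ∀ (n : ℕ) (P : ℕ → Prop), ∃ x, ∀ k < n, (P k → x ∈ B k) ∧ (¬ P k → x ∈ A k)) :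
    IsIndependentSeq A B := by
  intro n ε
  obtain ⟨x, hx⟩ := h n fun m => ∃ hm : m < n, ε ⟨m, hm⟩ = true
  refine ⟨x, Set.mem_iInter.2 fun k => ?_⟩
  obtain ⟨h1, h2⟩ := hx k k.2
  by_cases hk : ε k = true
  · simpa [hk] using h1 ⟨k.2, hk⟩
  · simpa [hk] using h2 fun ⟨_, h⟩ => hk h

/-- Restrictions of `x` to finite subsets of a sequence of coordinates depend continuously on the
finite subset. -/
theorem exists_forall_filter_eq_mem_of_isOpen {Γ : Type*} {K : Set (Γ → ℝ)} {x : Γ → ℝ}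
    {γ : ℕ → Γ} (hγ : Injective γ) (z : Finset ℕ → K)
    (hz : ∀ F, (z F : Γ → ℝ) = (γ '' (F : Set ℕ)).indicator x) (F : Finset ℕ) {O : Set K}
    (hO : IsOpen O) (hF : z F ∈ O) :
    ∃ N : ℕ, ∀ G : Finset ℕ, G.filter (· < N) = F.filter (· < N) → z G ∈ O := by
  by_contra! hcon
  choose G hG hGO using hcon
  have ht : Filter.Tendsto (fun N => z (G N)) Filter.atTop (nhds (z F)) := by
    rw [tendsto_subtype_rng, tendsto_pi_nhds]
    intro δ
    refine tendsto_const_nhds.congr' ?_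
    by_cases hδ : δ ∈ range γ
    · obtain ⟨k, rfl⟩ := hδ
      filter_upwards [Filter.eventually_gt_atTop k] with N hN
      have h1 : k ∈ G N ↔ k ∈ F := by
        have := Finset.ext_iff.1 (hG N) k
        simpa [hN] using this
      rw [hz, hz]
      by_cases hk : k ∈ F
      · rw [indicator_of_mem (mem_image_of_mem _ hk),
          indicator_of_mem (mem_image_of_mem _ (h1.2 hk))]
      · rw [indicator_of_notMem, indicator_of_notMem]
        · rw [hγ.mem_set_image]; exact fun h => hk (h1.1 h)
        · rw [hγ.mem_set_image]; exact hk
    · refine Filter.Eventually.of_forall fun N => ?_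
      simp only [hz]
      rw [indicator_of_notMem, indicator_of_notMem]
      all_goals exact fun h => hδ (image_subset_range _ _ h)
  obtain ⟨N, hN⟩ := (ht.eventually (hO.mem_nhds hF)).exists
  exact hGO N hN

/-- The open set of points whose `l`-th coordinate is below `p` (if `b`) or above `q` (if not). -/
def sideSet {K Λ : Type*} (i : K → Λ → unitInterval) (l : Λ) (p q : ℚ) (b : Bool) : Set K :=
  if b then {x | (i x l : ℝ) < p} else {x | (i x l : ℝ) > q}

theorem isOpen_sideSet {K Λ : Type*} [TopologicalSpace K] {i : K → Λ → unitInterval}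
    (hi : Continuous i) (l : Λ) (p q : ℚ) (b : Bool) : IsOpen (sideSet i l p q b) := by
  have hl : Continuous fun x => (i x l : ℝ) :=
    continuous_subtype_val.comp ((continuous_apply l).comp hi)
  cases b
  · exact isOpen_lt continuous_const hl
  · exact isOpen_lt hl continuous_const

/-- Disjoint compact sets are separated by finitely many coordinates of an embedding. -/
theorem exists_finite_separation {K Λ : Type*} [TopologicalSpace K]
    {i : K → Λ → unitInterval} (hi : Continuous i) (hinj : Injective i) {C D : Set K}
    (hC : IsCompact C) (hD : IsCompact D) (hCD : Disjoint C D) :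
    ∃ (r : ℕ) (l : Fin r → Λ) (p q : Fin r → ℚ) (b : Fin r → Bool), (∀ j, p j < q j) ∧
      ∀ x ∈ C, ∀ y ∈ D, ∃ j, x ∈ sideSet i (l j) (p j) (q j) (b j) ∧
        y ∈ sideSet i (l j) (p j) (q j) (!b j) := by
  let J := {a : Λ × ℚ × ℚ × Bool // a.2.1 < a.2.2.1}
  let O : J → Set (K × K) := fun a =>
    sideSet i a.1.1 a.1.2.1 a.1.2.2.1 a.1.2.2.2 ×ˢ sideSet i a.1.1 a.1.2.1 a.1.2.2.1 (!a.1.2.2.2)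
  obtain ⟨t, ht⟩ := (hC.prod hD).elim_finite_subcover O
    (fun a => (isOpen_sideSet hi _ _ _ _).prod (isOpen_sideSet hi _ _ _ _)) (by
      rintro ⟨x, y⟩ ⟨hx, hy⟩
      have hne : i x ≠ i y := fun h => disjoint_left.1 hCD hx (by rw [hinj h]; exact hy)
      obtain ⟨l, hl⟩ := Function.ne_iff.1 hne
      have hl' : (i x l : ℝ) ≠ i y l := fun h => hl (Subtype.ext h)
      rw [mem_iUnion]
      rcases lt_or_gt_of_ne hl' with h | h
      · obtain ⟨p, hp1, hp2⟩ := exists_rat_btwn h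
        obtain ⟨q, hq1, hq2⟩ := exists_rat_btwn hp2
        exact ⟨⟨(l, p, q, true), by exact_mod_cast hq1⟩, hp1, hq2⟩
      · obtain ⟨p, hp1, hp2⟩ := exists_rat_btwn h
        obtain ⟨q, hq1, hq2⟩ := exists_rat_btwn hp2
        exact ⟨⟨(l, p, q, false), by exact_mod_cast hq1⟩, hq2, hp1⟩)
  let e := t.equivFin.symm
  refine ⟨t.card, fun j => (e j).1.1.1, fun j => (e j).1.1.2.1, fun j => (e j).1.1.2.2.1,
    fun j => (e j).1.1.2.2.2, fun j => (e j).1.2, fun x hx y hy => ?_⟩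
  obtain ⟨a, ha, hxy⟩ := mem_iUnion₂.1 (ht (mk_mem_prod hx hy))
  refine ⟨e.symm ⟨a, ha⟩, ?_⟩
  simp only [Equiv.apply_symm_apply]
  exact hxy

/-- A solid compact set which is quasi weakly Radon–Nikodým splits, for every threshold, into
countably many sets of coordinates on each of which every point exceeds the threshold only
finitely often. -/
theorem IsQWRN.exists_decomposition {Γ : Type*} {K : Set (Γ → ℝ)} (hcomp : IsCompact K)
    (hsolid : ∀ x ∈ K, ∀ A : Finset Γ, (A : Set Γ).indicator x ∈ K) (hQ : IsQWRN K)
    {δ : ℝ} (hδ : 0 < δ) :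
    ∃ τ : Γ → ℕ, ∀ x ∈ K, ∀ n, {γ | τ γ = n ∧ δ ≤ |x γ|}.Finite := by
  classical
  obtain ⟨Λ, i, hi, hdec⟩ := hQ
  have : CompactSpace K := isCompact_iff_compactSpace.1 hcomp
  have hcls : ∀ p q : ℚ, ∃ cls : Λ → ℕ, p < q → ∀ φ : ℕ → Λ, (∀ m, cls (φ m) = cls (φ 0)) →
      ¬ IsIndependentSeq (fun m => {x : K | (i x (φ m) : ℝ) < p})
        (fun m => {x : K | (i x (φ m) : ℝ) > q}) := by
    intro p q
    by_cases hpq : p < q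
    · have hpq' : (p : ℝ) < q := by exact_mod_cast hpq
      obtain ⟨Γs, hΓs, h⟩ := hdec (((q : ℝ) - p) / 2) (by linarith)
      have hmem : ∀ l, ∃ n, l ∈ Γs n := fun l => mem_iUnion.1 (hΓs ▸ mem_univ l)
      choose cls hcls using hmem
      exact ⟨cls, fun _ φ hφ hind =>
        h (cls (φ 0)) p q (by linarith) ⟨φ, fun m => hφ m ▸ hcls _, hind⟩⟩
    · exact ⟨fun _ => 0, fun h => absurd h hpq⟩
  choose cls hcls using hcls
  let Code := Σ r : ℕ, Fin r → ℚ × ℚ × Bool × ℕ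
  let Good : Γ → Code → Prop := fun γ w => ∃ l : Fin w.1 → Λ,
    (∀ j, (w.2 j).1 < (w.2 j).2.1 ∧ cls (w.2 j).1 (w.2 j).2.1 (l j) = (w.2 j).2.2.2) ∧
    ∀ x y : K, δ ≤ |x.1 γ| → y.1 γ = 0 → ∃ j,
      x ∈ sideSet i (l j) (w.2 j).1 (w.2 j).2.1 (w.2 j).2.2.1 ∧
      y ∈ sideSet i (l j) (w.2 j).1 (w.2 j).2.1 (!(w.2 j).2.2.1)
  have hgood : ∀ γ, ∃ w, Good γ w := by
    intro γ
    have hev : Continuous fun x : K => x.1 γ := (continuous_apply γ).comp continuous_subtype_val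
    obtain ⟨r, l, p, q, b, hpq, h⟩ := exists_finite_separation (C := {x : K | δ ≤ |x.1 γ|})
      (D := {x : K | x.1 γ = 0}) hi.continuous hi.injective
      (isClosed_le continuous_const hev.abs).isCompact
      (isClosed_eq hev continuous_const).isCompact
      (disjoint_left.2 fun x (hx : δ ≤ |x.1 γ|) (hx' : x.1 γ = 0) => by
        rw [hx', abs_zero] at hx; linarith)
    exact ⟨⟨r, fun j => (p j, q j, b j, cls (p j) (q j) (l j))⟩, l, fun j => ⟨hpq j, rfl⟩,
      fun x y hx hy => h x hx y hy⟩
  choose w hw using hgood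
  obtain ⟨enc, henc⟩ := exists_injective_nat Code
  refine ⟨fun γ => enc (w γ), fun x hx n => ?_⟩
  by_contra hinf
  let emb := Set.Infinite.natEmbedding _ hinf
  let γ : ℕ → Γ := fun k => (emb k).1
  have hγ : Injective γ := Subtype.val_injective.comp emb.injective
  have hγδ : ∀ k, δ ≤ |x (γ k)| := fun k => (emb k).2.2
  obtain ⟨w₀, hw₀⟩ : ∃ w₀, ∀ k, w (γ k) = w₀ :=
    ⟨w (γ 0), fun k => henc ((emb k).2.1.trans (emb 0).2.1.symm)⟩
  have hG : ∀ k, Good (γ k) w₀ := fun k => hw₀ k ▸ hw (γ k)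
  choose l hl hsep using hG
  let z : Finset ℕ → K := fun F => ⟨(γ '' (F : Set ℕ)).indicator x, by
    simpa using hsolid x hx (F.image γ)⟩
  have hz : ∀ F, (z F : Γ → ℝ) = (γ '' (F : Set ℕ)).indicator x := fun _ => rfl
  have hz1 : ∀ F k, k ∈ F → (z F).1 (γ k) = x (γ k) := fun F k hk => by
    rw [hz, indicator_of_mem (mem_image_of_mem _ hk)]
  have hz0 : ∀ F k, k ∉ F → (z F).1 (γ k) = 0 := fun F k hk => by
    rw [hz, indicator_of_notMem]
    rw [hγ.mem_set_image]; exact hk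
  have hcol : ∀ (k : ℕ) (F : Finset ℕ), ∃ j : Fin w₀.1, k ∉ F →
      z (insert k F) ∈ sideSet i (l k j) (w₀.2 j).1 (w₀.2 j).2.1 (w₀.2 j).2.2.1 ∧
      z F ∈ sideSet i (l k j) (w₀.2 j).1 (w₀.2 j).2.1 (!(w₀.2 j).2.2.1) := by
    intro k F
    obtain ⟨j, hj⟩ := hsep k (z {k}) (z ∅) (by rw [hz1 _ _ (by simp)]; exact hγδ k)
      (hz0 _ _ (by simp))
    by_cases hk : k ∈ F
    · exact ⟨j, fun h => absurd hk h⟩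
    · obtain ⟨j, hj⟩ := hsep k (z (insert k F)) (z F)
        (by rw [hz1 _ _ (by simp)]; exact hγδ k) (hz0 _ _ hk)
      exact ⟨j, fun _ => hj⟩
  choose c hc using hcol
  have hN : ∀ (k : ℕ) (F : Finset ℕ), ∃ N, k ∉ F → ∀ G : Finset ℕ,
      (G.filter (· < N) = (insert k F).filter (· < N) → z G ∈
        sideSet i (l k (c k F)) (w₀.2 (c k F)).1 (w₀.2 (c k F)).2.1 (w₀.2 (c k F)).2.2.1) ∧
      (G.filter (· < N) = F.filter (· < N) → z G ∈
        sideSet i (l k (c k F)) (w₀.2 (c k F)).1 (w₀.2 (c k F)).2.1 (!(w₀.2 (c k F)).2.2.1)) := by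
    intro k F
    by_cases hk : k ∈ F
    · exact ⟨0, fun h => absurd hk h⟩
    obtain ⟨h1, h2⟩ := hc k F hk
    obtain ⟨N₁, hN₁⟩ := exists_forall_filter_eq_mem_of_isOpen hγ z hz _
      (isOpen_sideSet hi.continuous _ _ _ _) h1
    obtain ⟨N₂, hN₂⟩ := exists_forall_filter_eq_mem_of_isOpen hγ z hz _
      (isOpen_sideSet hi.continuous _ _ _ _) h2
    have hmono : ∀ {G H : Finset ℕ} {M N : ℕ}, M ≤ N → G.filter (· < N) = H.filter (· < N) →
        G.filter (· < M) = H.filter (· < M) := by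
      intro G H M N hMN h
      ext m
      have := Finset.ext_iff.1 h m
      simp only [Finset.mem_filter] at this ⊢
      constructor <;> rintro ⟨h1, h2⟩
      · exact ⟨(this.1 ⟨h1, by omega⟩).1, h2⟩
      · exact ⟨(this.2 ⟨h1, by omega⟩).1, h2⟩
    exact ⟨max N₁ N₂, fun _ G => ⟨fun h => hN₁ G (hmono (le_max_left _ _) h),
      fun h => hN₂ G (hmono (le_max_right _ _) h)⟩⟩
  choose N hN using hN
  obtain ⟨j, k, hk⟩ := exists_monochromatic_subtree c
    (fun k => (Finset.range k).powerset.sup (N k))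
  refine hcls (w₀.2 j).1 (w₀.2 j).2.1 (hl 0 j).1 (fun m => l (k m) j)
    (fun m => ((hl (k m) j).2).trans ((hl (k 0) j).2).symm)
    (isIndependentSeq_of_exists fun n P => ?_)
  obtain ⟨G, hG⟩ := hk n fun m => (P m ↔ (w₀.2 j).2.2.1 = false)
  refine ⟨z G, fun m hm => ?_⟩
  obtain ⟨hcm, hkm, hgap⟩ := hG m hm
  set F := G.filter (· < k m) with hF
  have hkF : k m ∉ F := by simp [hF]
  have hNle : N (k m) F ≤ (Finset.range (k m)).powerset.sup (N (k m)) :=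
    Finset.le_sup (Finset.mem_powerset.2 fun a ha =>
      Finset.mem_range.2 (Finset.mem_filter.1 ha).2)
  have hside := hN (k m) F hkF G
  rw [hcm] at hside
  have hmem : ∀ a < N (k m) F, a ∈ G → a ≠ k m → a ∈ F := by
    intro a ha haG hne
    refine Finset.mem_filter.2 ⟨haG, ?_⟩
    by_contra hlt
    have := hgap a haG (by omega)
    omega
  have hFG : F ⊆ G := Finset.filter_subset _ _
  by_cases hkG : k m ∈ G
  · have h1 := hside.1 (by
      ext a
      simp only [Finset.mem_filter, Finset.mem_insert]
      constructor
      · rintro ⟨h1, h2⟩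
        exact ⟨or_iff_not_imp_left.2 (hmem a h2 h1), h2⟩
      · rintro ⟨rfl | h1, h2⟩
        · exact ⟨hkG, h2⟩
        · exact ⟨hFG h1, h2⟩)
    have h2 := hkm.1 hkG
    cases hb : (w₀.2 j).2.2.1 <;> simp only [hb, sideSet] at h1 h2
    · exact ⟨fun _ => by simpa using h1, fun h => absurd (h2.2 trivial) h⟩
    · exact ⟨fun h => by simpa using h2.1 h, fun _ => by simpa using h1⟩
  · have h1 := hside.2 (by
      ext a
      simp only [Finset.mem_filter]
      constructor
      · rintro ⟨h1, h2⟩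
        exact ⟨hmem a h2 h1 fun h => hkG (h ▸ h1), h2⟩
      · rintro ⟨h1, h2⟩
        exact ⟨hFG h1, h2⟩)
    have h2 := fun h => hkG (hkm.2 h)
    cases hb : (w₀.2 j).2.2.1 <;> simp only [hb, sideSet] at h1 h2
    · refine ⟨fun h => absurd ⟨fun _ => trivial, fun _ => h⟩ h2, fun _ => by simpa using h1⟩
    · refine ⟨fun _ => by simpa using h1, fun h => absurd ⟨fun h' => absurd h' h, fun h' => ?_⟩ h2⟩
      simp at h'

/-- Truncation of the real line at level `δ`, rescaled to `[-1, 1]`. -/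
noncomputable def softThreshold (δ t : ℝ) : ℝ :=
  Real.arctan (t - max (-δ) (min t δ)) / 2

theorem continuous_softThreshold (δ : ℝ) : Continuous (softThreshold δ) := by
  unfold softThreshold
  have := Real.continuous_arctan
  fun_prop

theorem abs_softThreshold_le_one (δ t : ℝ) : |softThreshold δ t| ≤ 1 := by
  unfold softThreshold
  have h1 := Real.arctan_lt_pi_div_two (t - max (-δ) (min t δ))
  have h2 := Real.neg_pi_div_two_lt_arctan (t - max (-δ) (min t δ))
  have := Real.pi_lt_four
  rw [abs_le]
  constructor <;> linarith

theorem lt_abs_of_softThreshold_ne_zero {δ t : ℝ} (h : softThreshold δ t ≠ 0) : δ < |t| := by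
  contrapose! h
  obtain ⟨h1, h2⟩ := abs_le.1 h
  simp [softThreshold, min_eq_left h2, max_eq_right h1]

theorem softThreshold_ne {δ s t : ℝ} (hδ : 0 ≤ δ) (h : 2 * δ < |s - t|) :
    softThreshold δ s ≠ softThreshold δ t := by
  intro heq
  have h1 : s - max (-δ) (min s δ) = t - max (-δ) (min t δ) := by
    apply Real.arctan_injective
    simp only [softThreshold] at heq
    linarith
  have hb : ∀ r : ℝ, -δ ≤ max (-δ) (min r δ) ∧ max (-δ) (min r δ) ≤ δ := fun r =>
    ⟨le_max_left _ _, max_le (by linarith) (min_le_right _ _)⟩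
  have := hb s
  have := hb t
  have : |s - t| ≤ 2 * δ := abs_le.2 ⟨by linarith, by linarith⟩
  linarith

/-- A solid quasi weakly Radon–Nikodým compact set carries a separating family of functions
`φ i`, `i ∈ I`, split into countably many pieces, such that the supports on each piece belong to a
family `𝓐` of finite sets with no infinite set having all its finite subsets in `𝓐`. -/
theorem IsQWRN.exists_finite_support_family {Γ : Type*} {K : Set (Γ → ℝ)} (hcomp : IsCompact K)
    (hsolid : ∀ x ∈ K, ∀ A : Finset Γ, (A : Set Γ).indicator x ∈ K) (hQ : IsQWRN K) :
    ∃ (I : Type) (e : I → ℕ) (𝓐 : Set (Finset I)) (φ : I → K → ℝ),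
      ∅ ∈ 𝓐 ∧ (∀ i, {i} ∈ 𝓐) ∧
      (∀ S : Set I, S.Infinite → ∃ F : Finset I, (F : Set I) ⊆ S ∧ F ∉ 𝓐) ∧
      (∀ i, Continuous (φ i)) ∧ (∀ i x, |φ i x| ≤ 1) ∧
      (∀ x y, (∀ i, φ i x = φ i y) → x = y) ∧
      ∀ x n (F : Finset I), (∀ i ∈ F, e i = n ∧ φ i x ≠ 0) → F ∈ 𝓐 := by
  classical
  have : CompactSpace K := isCompact_iff_compactSpace.1 hcomp
  let δ : ℕ → ℝ := fun m => 1 / ((m : ℝ) + 1)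
  have hδ : ∀ m, 0 < δ m := fun m => Nat.one_div_pos_of_nat
  choose τ hτ using fun m => hQ.exists_decomposition hcomp hsolid (hδ m)
  let J := {a : ℕ × Γ // ∃ x ∈ K, δ a.1 ≤ |x a.2|}
  have hsmall : Small.{0} J := by
    obtain ⟨Λ, i, hi, -⟩ := hQ
    choose x hxK hx using fun a : J => a.2
    let u : J → K := fun a => ⟨(({a.1.2} : Finset Γ) : Set Γ).indicator (x a), hsolid _ (hxK a) _⟩
    refine small_of_injective (f := fun a : J => (a.1.1, i (u a))) fun a b hab => ?_
    obtain ⟨h1, h2⟩ := Prod.mk.inj hab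
    have h3 : (u a).1 a.1.2 = (u b).1 a.1.2 := by rw [hi.injective h2]
    have h4 : x a a.1.2 ≠ 0 := fun h => by
      have := hx a; rw [h, abs_zero] at this; linarith [hδ a.1.1]
    refine Subtype.ext (Prod.ext h1 ?_)
    by_contra hne
    exact h4 (by simpa [u, hne] using h3)
  let a : Shrink.{0} J → ℕ × Γ := fun i => ((equivShrink J).symm i).1
  have ha : Injective a := Subtype.val_injective.comp (equivShrink J).symm.injective
  have hmem : ∀ i, ∃ x ∈ K, δ (a i).1 ≤ |x (a i).2| := fun i => ((equivShrink J).symm i).2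
  let W : Shrink.{0} J → Set K := fun i => {x | δ (a i).1 ≤ |x.1 (a i).2|}
  have hcont : ∀ γ, Continuous fun x : K => x.1 γ := fun γ =>
    (continuous_apply γ).comp continuous_subtype_val
  have hW : ∀ i, IsClosed (W i) := fun i => isClosed_le continuous_const (hcont _).abs
  let e : Shrink.{0} J → ℕ := fun i => Nat.pair (a i).1 (τ (a i).1 (a i).2)
  have hfin : ∀ (x : K) n, {i | e i = n ∧ x ∈ W i}.Finite := by
    intro x n
    have h1 := (hτ n.unpair.1 x x.2 n.unpair.2).image (Prod.mk n.unpair.1)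
    refine (h1.preimage ha.injOn).subset ?_
    rintro i ⟨rfl, hi⟩
    have hi' : δ (a i).1 ≤ |x.1 (a i).2| := hi
    exact ⟨(a i).2, by simpa [e] using hi', by simp [e]⟩
  refine ⟨Shrink.{0} J, e,
    {F | F.Nonempty → (∃ x, ∀ i ∈ F, x ∈ W i) ∧ ∀ i ∈ F, ∀ j ∈ F, e i = e j},
    fun i x => softThreshold (δ (a i).1) (x.1 (a i).2), ?_, ?_, ?_, ?_, ?_, ?_, ?_⟩
  · exact fun h => absurd h Finset.not_nonempty_empty
  · intro i _
    obtain ⟨x, hxK, hx⟩ := hmem i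
    refine ⟨⟨⟨x, hxK⟩, fun j hj => ?_⟩, fun j hj k hk => ?_⟩
    · rw [Finset.mem_singleton.1 hj]; exact hx
    · rw [Finset.mem_singleton.1 hj, Finset.mem_singleton.1 hk]
  · intro S hS
    by_contra! hcon
    obtain ⟨i₀, hi₀⟩ := hS.nonempty
    have he : ∀ i ∈ S, e i = e i₀ := fun i hi =>
      (hcon {i, i₀} (by simp [insert_subset_iff, hi, hi₀]) (by simp)).2 i (by simp) i₀ (by simp)
    obtain ⟨x, hx⟩ : (⋂ i : S, W i).Nonempty := by
      refine CompactSpace.iInter_nonempty (fun i => hW i) fun F => ?_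
      obtain ⟨⟨x, hx⟩, -⟩ := hcon (insert i₀ (F.map (Embedding.subtype _)))
        (by
          rw [Finset.coe_insert, insert_subset_iff]
          refine ⟨hi₀, fun j hj => ?_⟩
          simp only [Finset.coe_map, Embedding.subtype_apply, mem_image] at hj
          obtain ⟨k, -, rfl⟩ := hj
          exact k.2) (Finset.insert_nonempty _ _)
      exact ⟨x, mem_iInter₂.2 fun i hi => hx i (Finset.mem_insert_of_mem
        (Finset.mem_map_of_mem (Embedding.subtype _) hi))⟩
    exact hS ((hfin x (e i₀)).subset fun i hi => ⟨he i hi, mem_iInter.1 hx ⟨i, hi⟩⟩)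
  · exact fun i => (continuous_softThreshold _).comp (hcont _)
  · exact fun i x => abs_softThreshold_le_one _ _
  · intro x y hxy
    by_contra hne
    obtain ⟨γ, hγ⟩ := Function.ne_iff.1 fun h => hne (Subtype.ext h)
    have hpos : 0 < |x.1 γ - y.1 γ| / 2 := by
      have := abs_pos.2 (sub_ne_zero.2 hγ); linarith
    obtain ⟨m, hm⟩ := exists_nat_one_div_lt hpos
    change δ m < _ at hm
    have hJ : ∃ z ∈ K, δ m ≤ |z γ| := by
      by_contra! hcon
      have h1 := hcon x x.2
      have h2 := hcon y y.2
      have := abs_sub (x.1 γ) (y.1 γ)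
      linarith
    have h1 := hxy (equivShrink J ⟨(m, γ), hJ⟩)
    simp only [a, Equiv.symm_apply_apply] at h1
    exact softThreshold_ne (hδ m).le (by linarith) h1
  · intro x n F hF _
    exact ⟨⟨x, fun i hi => (lt_abs_of_softThreshold_ne_zero (hF i hi).2).le⟩,
      fun i hi j hj => (hF i hi).1.trans (hF j hj).1.symm⟩

open ZeroAtInfty in
/-- A function on a discrete space that is small off finite sets, as an element of `c₀`. -/
def zeroAtInftyOfDiscrete {I : Type*} [TopologicalSpace I] [DiscreteTopology I] (f : I → ℝ)
    (hf : Filter.Tendsto f Filter.cofinite (nhds 0)) : C₀(I, ℝ) where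
  toFun := f
  continuous_toFun := continuous_of_discreteTopology
  zero_at_infty' := by rwa [Filter.cocompact_eq_cofinite]

open ZeroAtInfty in
theorem ZeroAtInftyContinuousMap.norm_le_of_forall {I : Type*} [TopologicalSpace I]
    {f : C₀(I, ℝ)} {C : ℝ} (hC : 0 ≤ C) (h : ∀ i, |f i| ≤ C) : ‖f‖ ≤ C := by
  rw [← ZeroAtInftyContinuousMap.norm_toBCF_eq_norm]
  exact (BoundedContinuousFunction.norm_le hC).2 h

open ZeroAtInfty in
open scoped Classical in
/-- The canonical unit vectors of `c₀`. -/
noncomputable def c0UnitVector {I : Type*} [TopologicalSpace I] [DiscreteTopology I] (i : I) :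
    C₀(I, ℝ) :=
  zeroAtInftyOfDiscrete (Pi.single i 1) <| by
    refine tendsto_const_nhds.congr' ?_
    filter_upwards [(finite_singleton i).compl_mem_cofinite] with j hj
    rw [Pi.single_eq_of_ne hj]

open ZeroAtInfty in
open scoped Classical in
theorem sum_smul_c0UnitVector_apply {I : Type*} [TopologicalSpace I] [DiscreteTopology I]
    (s : Finset I) (a : I → ℝ) (j : I) :
    (∑ i ∈ s, a i • c0UnitVector i : C₀(I, ℝ)) j = if j ∈ s then a j else 0 := by
  have h : ∀ t : Finset I, (∑ i ∈ t, a i • c0UnitVector i : C₀(I, ℝ)) j =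
      ∑ i ∈ t, a i * (Pi.single i 1 : I → ℝ) j := by
    intro t
    induction t using Finset.induction_on with
    | empty => simp
    | insert i t hi ih => rw [Finset.sum_insert hi, Finset.sum_insert hi, ← ih]; rfl
  simp [h, Pi.single_apply]

open ZeroAtInfty in
theorem hasSum_smul_c0UnitVector {I : Type*} [TopologicalSpace I] [DiscreteTopology I]
    (f : C₀(I, ℝ)) : HasSum (fun i => f i • c0UnitVector i) f := by
  classical
  rw [HasSum, SummationFilter.unconditional_filter, Metric.tendsto_atTop]
  intro ε hε
  have h0 := f.zero_at_infty'
  rw [Filter.cocompact_eq_cofinite, Metric.tendsto_nhds] at h0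
  have hfin := Filter.eventually_cofinite.1 (h0 (ε / 2) (half_pos hε))
  refine ⟨hfin.toFinset, fun s hs => ?_⟩
  rw [dist_eq_norm]
  refine (ZeroAtInftyContinuousMap.norm_le_of_forall (half_pos hε).le fun i => ?_).trans_lt
    (half_lt_self hε)
  rw [ZeroAtInftyContinuousMap.sub_apply, sum_smul_c0UnitVector_apply]
  split_ifs with hi
  · simpa using (half_pos hε).le
  · have hi' : i ∉ hfin.toFinset := fun h => hi (hs h)
    rw [Finite.mem_toFinset, mem_ofPred_eq, not_not, Real.dist_0_eq_abs] at hi'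
    rw [zero_sub, abs_neg]
    exact hi'.le

open ZeroAtInfty in
theorem summable_dual_c0UnitVector {I : Type*} [TopologicalSpace I] [DiscreteTopology I]
    (ψ : StrongDual ℝ C₀(I, ℝ)) : Summable fun i => |ψ (c0UnitVector i)| := by
  classical
  refine summable_of_sum_le (c := ‖ψ‖) (fun i => abs_nonneg _) fun s => ?_
  let a : I → ℝ := fun i => SignType.sign (ψ (c0UnitVector i))
  have ha : ∀ i, |a i| ≤ 1 := fun i => by
    rcases lt_trichotomy (ψ (c0UnitVector i)) 0 with h | h | h <;> simp [a, h]
  have h1 : ψ (∑ i ∈ s, a i • c0UnitVector i) = ∑ i ∈ s, |ψ (c0UnitVector i)| := by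
    simp [a, map_sum, sign_mul_self]
  rw [← h1]
  refine (le_abs_self _).trans ((ψ.le_opNorm _).trans ?_)
  refine mul_le_of_le_one_right (norm_nonneg _) ?_
  refine ZeroAtInftyContinuousMap.norm_le_of_forall zero_le_one fun j => ?_
  rw [sum_smul_c0UnitVector_apply]
  split_ifs
  · exact ha j
  · simp

open ZeroAtInfty in
theorem isEberlein_of_separating {K : Type*} [TopologicalSpace K] [CompactSpace K] {I : Type}
    (e : I → ℕ) (φ : I → K → ℝ) (hcont : ∀ i, Continuous (φ i)) (hle : ∀ i x, |φ i x| ≤ 1)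
    (hsep : ∀ x y, (∀ i, φ i x = φ i y) → x = y)
    (hfin : ∀ x n, {i | e i = n ∧ φ i x ≠ 0}.Finite) : IsEberlein K := by
  let _ : TopologicalSpace I := ⊥
  have : DiscreteTopology I := ⟨rfl⟩
  let w : ℕ → ℝ := fun n => (1 / 2) ^ n
  have hw : ∀ n, 0 < w n := fun n => by positivity
  have hw1 : ∀ n, w n ≤ 1 := fun n => pow_le_one₀ (by norm_num) (by norm_num)
  have hbd : ∀ i x, |w (e i) * φ i x| ≤ w (e i) := fun i x => by
    rw [abs_mul, abs_of_pos (hw _)]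
    exact mul_le_of_le_one_right (hw _).le (hle i x)
  have htend : ∀ x, Filter.Tendsto (fun i => w (e i) * φ i x) Filter.cofinite (nhds 0) := by
    intro x
    rw [Metric.tendsto_nhds]
    intro ε hε
    obtain ⟨N, hN⟩ := exists_pow_lt_of_lt_one hε (show (1 / 2 : ℝ) < 1 by norm_num)
    rw [Filter.eventually_cofinite]
    refine ((finite_lt_nat N).biUnion fun n _ => hfin x n).subset fun i hi => ?_
    rw [mem_ofPred_eq, not_lt, Real.dist_0_eq_abs] at hi
    refine mem_biUnion (x := e i) ?_ ⟨rfl, fun h0 => ?_⟩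
    · change e i < N
      by_contra! h
      exact absurd ((hi.trans (hbd i x)).trans
        (pow_le_pow_of_le_one (by norm_num) (by norm_num) h)) (not_le.2 hN)
    · rw [h0, mul_zero, abs_zero] at hi
      exact absurd hi (not_le.2 hε)
  let F : K → WeakSpace ℝ C₀(I, ℝ) := fun x =>
    toWeakSpace ℝ C₀(I, ℝ) (zeroAtInftyOfDiscrete _ (htend x))
  have hF : Continuous F := by
    refine WeakBilin.continuous_of_continuous_eval (topDualPairing ℝ C₀(I, ℝ)).flip fun ψ => ?_
    have h1 : ∀ x, ψ (zeroAtInftyOfDiscrete _ (htend x)) =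
        ∑' i, (w (e i) * φ i x) * ψ (c0UnitVector i) := fun x => by
      have := (hasSum_smul_c0UnitVector (zeroAtInftyOfDiscrete _ (htend x))).mapL ψ
      simp only [map_smul, smul_eq_mul] at this
      exact this.tsum_eq.symm
    change Continuous fun x => ψ (zeroAtInftyOfDiscrete _ (htend x))
    simp_rw [h1]
    refine continuous_tsum (fun i => by have := hcont i; fun_prop)
      (summable_dual_c0UnitVector ψ) fun i x => ?_
    rw [norm_mul, Real.norm_eq_abs, Real.norm_eq_abs]
    exact mul_le_of_le_one_left (abs_nonneg _) ((hbd i x).trans (hw1 _))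
  have hinj : Injective F := fun x y hxy => hsep x y fun i => by
    have h := DFunLike.congr_fun ((toWeakSpace ℝ C₀(I, ℝ)).injective hxy) i
    exact mul_left_cancel₀ (hw (e i)).ne' h
  exact ⟨C₀(I, ℝ), inferInstance, inferInstance, inferInstance, range F, isCompact_range hF,
    ⟨(hF.isClosedEmbedding hinj).isEmbedding.toHomeomorph⟩⟩

open Filter Topology MeasureTheory in
open scoped CompactlySupported in
theorem exists_mem_convexHull_forall_lt {L : Type*} [TopologicalSpace L] [CompactSpace L]
    [T2Space L] (g : ℕ → C(L, ℝ)) {C : ℝ} (hC : ∀ k x, g k x ≤ C) (hg : ∀ k x, 0 ≤ g k x)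
    (h0 : ∀ x, Tendsto (fun k => g k x) atTop (𝓝 0)) {ε : ℝ} (hε : 0 < ε) :
    ∃ f ∈ convexHull ℝ (range g), ∀ x, f x < ε := by
  by_contra! hcon
  have hopen : IsOpen {f : C(L, ℝ) | ∀ x, f x < ε} := by
    have := ContinuousMap.isOpen_setOfPred_mapsTo (X := L) (Y := ℝ) isCompact_univ
      (isOpen_Iio (a := ε))
    simpa [MapsTo] using this
  have hconv : Convex ℝ {f : C(L, ℝ) | ∀ x, f x < ε} := by
    intro f hf f' hf' a b ha hb hab x
    exact convex_Iio ε (hf x) (hf' x) ha hb hab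
  obtain ⟨ψ, s, hlt, hge⟩ := geometric_hahn_banach_open hconv hopen
    (convex_convexHull ℝ (range g)) (disjoint_left.2 fun f hf hf' => by
      obtain ⟨x, hx⟩ := hcon f hf'
      exact absurd (hf x) (not_lt.2 hx))
  have hs : 0 < s := by simpa using hlt 0 fun _ => hε
  have hpos : ∀ f : C(L, ℝ), 0 ≤ f → 0 ≤ ψ f := by
    intro f hf
    by_contra! hneg
    have h1 := hlt ((s / ψ f) • f) fun x => by
      have h2 : s / ψ f * f x ≤ 0 :=
        mul_nonpos_of_nonpos_of_nonneg (div_nonpos_of_nonneg_of_nonpos hs.le hneg.le) (hf x)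
      exact h2.trans_lt hε
    rw [map_smul, smul_eq_mul, div_mul_cancel₀ _ hneg.ne] at h1
    exact lt_irrefl _ h1
  let Λ : C_c(L, ℝ) →ₚ[ℝ] ℝ := PositiveLinearMap.mk₀
    { toFun := fun f => ψ f.toContinuousMap
      map_add' := fun f f' => map_add ψ f.toContinuousMap f'.toContinuousMap
      map_smul' := fun r f => map_smul ψ r f.toContinuousMap }
    fun f hf => hpos f.toContinuousMap hf
  let _ : MeasurableSpace L := borel L
  have : BorelSpace L := ⟨rfl⟩
  have hrep : ∀ k, ∫ x, g k x ∂(RealRMK.rieszMeasure Λ) = ψ (g k) := fun k =>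
    RealRMK.integral_rieszMeasure Λ (CompactlySupportedContinuousMap.continuousMapEquiv (g k))
  have hlim := tendsto_integral_of_dominated_convergence
    (μ := RealRMK.rieszMeasure Λ) (F := fun k x => g k x) (f := fun _ => 0) (fun _ => C)
    (fun k => (g k).continuous.aestronglyMeasurable) (integrable_const C)
    (fun k => Eventually.of_forall fun x => by
      rw [Real.norm_of_nonneg (hg k x)]; exact hC k x)
    (Eventually.of_forall h0)
  rw [integral_zero] at hlim
  refine absurd (ge_of_tendsto' hlim fun k => ?_) (not_le.2 hs)
  rw [hrep]
  exact hge _ (subset_convexHull ℝ _ (mem_range_self k))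

open Filter Topology in
theorem exists_convex_combination_norm_lt {L : Type*} [TopologicalSpace L] [CompactSpace L]
    [T2Space L] (g : ℕ → C(L, ℝ)) {C : ℝ} (hC : ∀ k x, |g k x| ≤ C)
    (h0 : ∀ x, Tendsto (fun k => g k x) atTop (𝓝 0)) {ε : ℝ} (hε : 0 < ε) :
    ∃ (ι : Type) (t : Finset ι) (w : ι → ℝ) (k : ι → ℕ), (∀ i ∈ t, 0 ≤ w i) ∧
      ∑ i ∈ t, w i = 1 ∧ ‖∑ i ∈ t, w i • g (k i)‖ < ε := by
  obtain ⟨f, hf, hlt⟩ := exists_mem_convexHull_forall_lt (fun k => |g k|) (C := C)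
    (fun k x => hC k x) (fun k x => abs_nonneg _)
    (fun x => by simpa using (h0 x).abs) hε
  rw [convexHull_eq] at hf
  obtain ⟨ι, t, w, z, hw, hw1, hz, rfl⟩ := hf
  choose! k hk using hz
  refine ⟨ι, t, w, k, hw, hw1, (ContinuousMap.norm_lt_iff _ hε).2 fun x => ?_⟩
  refine lt_of_le_of_lt ?_ (hlt x)
  rw [Finset.centerMass_eq_of_sum_1 _ _ hw1, ContinuousMap.sum_apply, ContinuousMap.sum_apply]
  refine (norm_sum_le _ _).trans (Finset.sum_le_sum fun i hi => ?_)
  rw [← hk i hi, ContinuousMap.smul_apply, ContinuousMap.smul_apply, norm_smul,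
    Real.norm_of_nonneg (hw i hi)]
  exact le_rfl

/-- The functions on `L` vanishing at `z` whose value at each `y` is the combination of their
values at the points `u i` prescribed by `c y`. -/
def affineSubmodule {L I : Type*} [TopologicalSpace L] [CompactSpace L] (u : I → L) (z : L)
    (s : L → Finset I) (c : L → I → ℝ) : Submodule ℝ C(L, ℝ) where
  carrier := {f | f z = 0 ∧ ∀ y, f y = ∑ i ∈ s y, c y i * f (u i)}
  zero_mem' := by simp
  add_mem' := by
    rintro f f' ⟨h1, h2⟩ ⟨h1', h2'⟩
    refine ⟨by simp [h1, h1'], fun y => ?_⟩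
    simp only [ContinuousMap.add_apply, mul_add, Finset.sum_add_distrib]
    rw [h2 y, h2' y]
  smul_mem' := by
    rintro r f ⟨h1, h2⟩
    refine ⟨by simp [h1], fun y => ?_⟩
    simp only [ContinuousMap.smul_apply, smul_eq_mul]
    rw [h2 y, Finset.mul_sum]
    exact Finset.sum_congr rfl fun i _ => by ring

theorem isClosed_affineSubmodule {L I : Type*} [TopologicalSpace L] [CompactSpace L] (u : I → L)
    (z : L) (s : L → Finset I) (c : L → I → ℝ) :
    IsClosed (affineSubmodule u z s c : Set C(L, ℝ)) := by
  have h : ∀ y : L, Continuous fun f : C(L, ℝ) => f y := continuous_eval_const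
  have h1 : (affineSubmodule u z s c : Set C(L, ℝ)) =
      {f | f z = 0} ∩ ⋂ y, {f | f y = ∑ i ∈ s y, c y i * f (u i)} := by
    ext f
    simp only [mem_inter_iff, mem_iInter]
    rfl
  rw [h1]
  exact (isClosed_eq (h z) continuous_const).inter (isClosed_iInter fun y =>
    isClosed_eq (h y) (continuous_finsetSum _ fun i _ => continuous_const.mul (h _)))

open Filter Topology in
theorem exists_subseq_tendsto_of_countable_support {I : Type*} (f : ℕ → I → ℝ) {C : ℝ}
    (hC : ∀ k i, |f k i| ≤ C) (hf : ∀ k, {i | f k i ≠ 0}.Countable) :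
    ∃ n : ℕ → ℕ, StrictMono n ∧ ∀ i, ∃ a, Tendsto (fun k => f (n k) i) atTop (𝓝 a) := by
  let D : Set I := ⋃ k, {i | f k i ≠ 0}
  have hD : Countable D := (countable_iUnion hf).to_subtype
  obtain ⟨a, -, n, hn, ha⟩ :=
    IsCompact.tendsto_subseq (x := fun k (i : D) => f k i)
      (isCompact_univ_pi fun _ : D => isCompact_Icc (a := -C) (b := C))
      fun k i _ => abs_le.1 (hC k i)
  refine ⟨n, hn, fun i => ?_⟩
  by_cases hi : i ∈ D
  · exact ⟨a ⟨i, hi⟩, tendsto_pi_nhds.1 ha ⟨i, hi⟩⟩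
  · refine ⟨0, tendsto_const_nhds.congr fun k => ?_⟩
    by_contra h
    exact hi (mem_iUnion.2 ⟨n k, fun h' => h h'.symm⟩)

theorem one_le_norm_convex_combination_single {n : ℕ → ℕ} (hn : StrictMono n) {ι : Type*}
    (t : Finset ι) (w : ι → ℝ) (k : ι → ℕ) (hw1 : ∑ i ∈ t, w i = 1) :
    1 ≤ ‖∑ i ∈ t, w i • ((lp.single 1 (n (2 * k i)) 1 - lp.single 1 (n (2 * k i + 1)) 1 :
      lp (fun _ : ℕ => ℝ) 1))‖ := by
  classical
  set v := ∑ i ∈ t, w i • ((lp.single 1 (n (2 * k i)) 1 - lp.single 1 (n (2 * k i + 1)) 1 :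
      lp (fun _ : ℕ => ℝ) 1)) with hv
  let J : Finset ℕ := t.image fun i => n (2 * k i)
  have h1 : ∑ j ∈ J, |v j| ≤ ‖v‖ := by
    simpa using lp.sum_rpow_le_norm_rpow (p := 1) (by simp) v J
  have h2 : ∑ j ∈ J, v j = 1 := by
    have h3 : ∀ j, v j = ∑ i ∈ t, w i * ((Pi.single (n (2 * k i)) (1 : ℝ) : ℕ → ℝ) j -
        (Pi.single (n (2 * k i + 1)) (1 : ℝ) : ℕ → ℝ) j) := by
      intro j
      rw [hv, lp.coeFn_sum, Finset.sum_apply]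
      rfl
    simp_rw [h3]
    rw [Finset.sum_comm]
    refine Eq.trans ?_ hw1
    refine Finset.sum_congr rfl fun i hi => ?_
    rw [← Finset.mul_sum, Finset.sum_sub_distrib, Finset.sum_pi_single', Finset.sum_pi_single',
      if_pos (Finset.mem_image_of_mem _ hi), if_neg, sub_zero, mul_one]
    intro hmem
    obtain ⟨i', -, h⟩ := Finset.mem_image.1 hmem
    have := hn.injective h
    lia
  exact h2 ▸ (Finset.sum_le_sum fun j _ => le_abs_self (v j)).trans h1

open Filter Topology in
theorem not_containsL1_of_linearIsometry {L I X : Type*} [TopologicalSpace L] [CompactSpace L]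
    [T2Space L] [NormedAddCommGroup X] [NormedSpace ℝ X] (u : I → L) (z : L) (s : L → Finset I)
    (c : L → I → ℝ) (hu : Tendsto u cofinite (𝓝 z)) (j : X →ₗᵢ[ℝ] C(L, ℝ))
    (hz : ∀ x, j x z = 0) (hj : ∀ x y, j x y = ∑ i ∈ s y, c y i * j x (u i)) :
    ¬ ContainsL1 X := by
  rintro ⟨T, c₀, hc₀, hT⟩
  let f : ℕ → C(L, ℝ) := fun k => j (T (lp.single 1 k 1))
  have hbd : ∀ k y, |(f k) y| ≤ ‖T‖ := fun k y => by
    refine ((f k).norm_coe_le_norm y).trans ((j.norm_map _).trans_le ((T.le_opNorm _).trans ?_))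
    rw [lp.norm_single zero_lt_one, norm_one, mul_one]
  have hcount : ∀ k, {i | (f k) (u i) ≠ 0}.Countable := fun k => by
    have h := (((f k).continuous.tendsto z).comp hu)
    rw [hz] at h
    simpa [compl_def] using h.countable_compl_preimage_ker
  obtain ⟨n, hn, ha⟩ := exists_subseq_tendsto_of_countable_support
    (fun k i => (f k) (u i)) (fun k i => hbd k (u i)) hcount
  choose a ha using ha
  have hlim : ∀ y, Tendsto (fun k => (f (n k)) y) atTop (𝓝 (∑ i ∈ s y, c y i * a i)) := by
    intro y
    change Tendsto (fun k => j (T (lp.single 1 (n k) 1)) y) atTop _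
    simp_rw [fun k => hj (T (lp.single 1 (n k) 1)) y]
    exact tendsto_finsetSum _ fun i _ => (ha i).const_mul _
  have hlim0 : ∀ y, Tendsto (fun k => ((f (n (2 * k))) - (f (n (2 * k + 1)))) y) atTop
      (𝓝 0) := by
    intro y
    have h1 : Tendsto (fun k : ℕ => 2 * k) atTop atTop :=
      tendsto_atTop_mono (fun k => show k ≤ _ by lia) tendsto_id
    have h2 : Tendsto (fun k : ℕ => 2 * k + 1) atTop atTop :=
      tendsto_atTop_mono (fun k => show k ≤ _ by lia) tendsto_id
    simpa using ((hlim y).comp h1).sub ((hlim y).comp h2)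
  obtain ⟨ι, t, w, k, -, hw1, hlt⟩ := exists_convex_combination_norm_lt
    (fun k => (f (n (2 * k))) - (f (n (2 * k + 1)))) (C := ‖T‖ + ‖T‖)
    (fun k y => (abs_sub _ _).trans (add_le_add (hbd _ y) (hbd _ y))) hlim0 hc₀
  have h1 := one_le_norm_convex_combination_single hn t w k hw1
  have h2 := hT (∑ i ∈ t, w i • ((lp.single 1 (n (2 * k i)) 1 - lp.single 1 (n (2 * k i + 1)) 1 :
      lp (fun _ : ℕ => ℝ) 1)))
  have h3 : j (T (∑ i ∈ t, w i • ((lp.single 1 (n (2 * k i)) 1 -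
      lp.single 1 (n (2 * k i + 1)) 1 : lp (fun _ : ℕ => ℝ) 1)))) =
      ∑ i ∈ t, w i • ((f (n (2 * k i))) - (f (n (2 * k i + 1)))) := by
    simp [map_sum, f]
  rw [← j.norm_map, h3] at h2
  nlinarith

/-- The points of the cube `[-1, 1] ^ I` all of whose finite sets of nonzero coordinates belong
to `𝓐`. -/
def supportBox {I : Type*} (𝓐 : Set (Finset I)) : Set (I → ℝ) :=
  {y | (∀ i, |y i| ≤ 1) ∧ ∀ F : Finset I, (∀ i ∈ F, y i ≠ 0) → F ∈ 𝓐}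

theorem isCompact_supportBox {I : Type*} (𝓐 : Set (Finset I)) : IsCompact (supportBox 𝓐) := by
  have h : supportBox 𝓐 = (univ.pi fun _ => Icc (-1) 1) ∩
      ⋂ (F : Finset I) (_ : F ∉ 𝓐), ⋃ i ∈ F, {y | y i = 0} := by
    ext y
    simp only [supportBox, mem_ofPred_eq, mem_inter_iff, mem_pi, mem_univ, true_imp_iff, mem_Icc,
      abs_le, mem_iInter, mem_iUnion, exists_prop]
    refine and_congr_right fun _ => forall_congr' fun F => ?_
    rw [← not_imp_not]
    push Not
    rfl
  rw [h]
  refine (isCompact_univ_pi fun _ => isCompact_Icc).inter_right ?_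
  exact isClosed_iInter fun F => isClosed_iInter fun _ =>
    F.finite_toSet.isClosed_biUnion fun i _ => isClosed_eq (continuous_apply i) continuous_const

theorem finite_support_of_mem_supportBox {I : Type*} {𝓐 : Set (Finset I)}
    (h𝓐 : ∀ S : Set I, S.Infinite → ∃ F : Finset I, (F : Set I) ⊆ S ∧ F ∉ 𝓐) {y : I → ℝ}
    (hy : y ∈ supportBox 𝓐) : (support y).Finite := by
  by_contra hS
  obtain ⟨F, hF, hF'⟩ := h𝓐 _ hS
  exact hF' (hy.2 F fun i hi => hF hi)

open Filter Topology in
open scoped Classical in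
theorem isWRN_of_separating {K : Type*} [TopologicalSpace K] [CompactSpace K] {I : Type}
    (e : I → ℕ) (𝓐 : Set (Finset I)) (φ : I → K → ℝ) (hempty : ∅ ∈ 𝓐)
    (hsingle : ∀ i, {i} ∈ 𝓐)
    (h𝓐 : ∀ S : Set I, S.Infinite → ∃ F : Finset I, (F : Set I) ⊆ S ∧ F ∉ 𝓐)
    (hcont : ∀ i, Continuous (φ i)) (hle : ∀ i x, |φ i x| ≤ 1)
    (hsep : ∀ x y, (∀ i, φ i x = φ i y) → x = y)
    (hφ : ∀ x n (F : Finset I), (∀ i ∈ F, e i = n ∧ φ i x ≠ 0) → F ∈ 𝓐) : IsWRN K := by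
  have : CompactSpace (supportBox 𝓐) := isCompact_iff_compactSpace.1 (isCompact_supportBox 𝓐)
  let z : supportBox 𝓐 := ⟨0, by simp, fun F hF => by
    obtain rfl : F = ∅ := Finset.eq_empty_of_forall_notMem fun i hi => hF i hi rfl
    exact hempty⟩
  let u : I → supportBox 𝓐 := fun i => ⟨Pi.single i 1, fun j => by
    rw [Pi.single_apply]; split_ifs <;> simp, fun F hF => by
    have h : F ⊆ {i} := fun j hj => Finset.mem_singleton.2 <| by
      by_contra hne
      exact hF j hj (Pi.single_eq_of_ne hne _)
    rcases Finset.subset_singleton_iff.1 h with rfl | rfl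
    · exact hempty
    · exact hsingle i⟩
  have hu : Tendsto u cofinite (𝓝 z) := by
    rw [tendsto_subtype_rng, tendsto_pi_nhds]
    intro j
    refine tendsto_const_nhds.congr' ?_
    filter_upwards [(finite_singleton j).compl_mem_cofinite] with i hi
    exact (Pi.single_eq_of_ne (M := fun _ => ℝ) (Ne.symm hi) 1).symm
  let s : supportBox 𝓐 → Finset I := fun y => (finite_support_of_mem_supportBox h𝓐 y.2).toFinset
  let X := affineSubmodule u z s fun y i => y.1 i
  have : CompleteSpace X := (isClosed_affineSubmodule u z s fun y i => y.1 i).completeSpace_coe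
  let π : I → X := fun j => ⟨⟨fun y => y.1 j, (continuous_apply j).comp continuous_subtype_val⟩, rfl, fun y => by
    change y.1 j = ∑ i ∈ s y, y.1 i * (Pi.single i 1 : I → ℝ) j
    by_cases hj : y.1 j = 0 <;> simp [Pi.single_apply, s, hj]⟩
  let Y : ℕ → K → supportBox 𝓐 := fun n x => ⟨fun i => if e i = n then φ i x else 0,
    fun i => by dsimp only; split_ifs <;> simp [hle], fun F hF => hφ x n F fun i hi => by
      simpa using hF i hi⟩
  have hY : ∀ n, Continuous (Y n) := fun n =>
    Continuous.subtype_mk (continuous_pi fun i => by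
      by_cases h : e i = n
      · simpa only [h, if_true] using hcont i
      · simpa only [h, if_false] using continuous_const) _
  let w : ℕ → ℝ := fun n => (1 / 2) ^ n
  have hw : ∀ n, 0 < w n := fun n => by positivity
  have hwsum : Summable w := summable_geometric_two
  have hbd : ∀ (f : X) n x, ‖w n * f.1 (Y n x)‖ ≤ w n * ‖f‖ := fun f n x => by
    rw [norm_mul, Real.norm_of_nonneg (hw n).le]
    exact mul_le_mul_of_nonneg_left (f.1.norm_coe_le_norm _) (hw n).le
  have hsum : ∀ (f : X) x, Summable fun n => w n * f.1 (Y n x) := fun f x =>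
    Summable.of_norm_bounded (hwsum.mul_right _) fun n => hbd f n x
  let Θ₀ : K → X →ₗ[ℝ] ℝ := fun x =>
    { toFun := fun f => ∑' n, w n * f.1 (Y n x)
      map_add' := fun f f' => by
        rw [← (hsum f x).tsum_add (hsum f' x)]
        exact tsum_congr fun n => mul_add _ _ _
      map_smul' := fun r f => by
        rw [RingHom.id_apply, smul_eq_mul, ← tsum_mul_left]
        exact tsum_congr fun n => mul_left_comm _ _ _ }
  let Θ : K → WeakDual ℝ X := fun x => StrongDual.toWeakDual <|
    (Θ₀ x).mkContinuous (∑' n, w n) fun f =>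
      tsum_of_norm_bounded (hwsum.hasSum.mul_right _) fun n => hbd f n x
  have hΘ : Continuous Θ := WeakDual.continuous_of_continuous_eval fun f =>
    continuous_tsum (fun n => continuous_const.mul (f.1.continuous.comp (hY n)))
      (hwsum.mul_right _) (hbd f)
  have hΘπ : ∀ x j, Θ x (π j) = w (e j) * φ j x := by
    intro x j
    change ∑' n, w n * (if e j = n then φ j x else 0) = _
    rw [tsum_eq_single (e j) fun n hn => by rw [if_neg (Ne.symm hn), mul_zero], if_pos rfl]
  have hinj : Injective Θ := fun x y hxy => hsep x y fun j => by
    have h := hΘπ x j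
    rw [hxy, hΘπ y j] at h
    exact (mul_left_cancel₀ (hw _).ne' h).symm
  exact ⟨X, inferInstance, inferInstance, inferInstance, range Θ,
    not_containsL1_of_linearIsometry u z s (fun y i => y.1 i) hu X.subtypeₗᵢ
      (fun f => f.2.1) (fun f => f.2.2), isCompact_range hΘ,
    ⟨(hΘ.isClosedEmbedding hinj).isEmbedding.toHomeomorph⟩⟩

/-- For a solid compact subset `K` of the sigma-product `Σ(Γ) ⊆ ℝ^Γ`, the properties WRN,
QWRN and Eberlein are all equivalent. -/
theorem solid_sigmaProduct_isWRN_iff_isQWRN_iff_isEberlein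
    {Γ : Type*} (K : Set (Γ → ℝ)) (hcomp : IsCompact K)
    (hsigma : ∀ x ∈ K, {γ : Γ | x γ ≠ 0}.Countable)
    (hsolid : ∀ x ∈ K, ∀ A : Finset Γ, (A : Set Γ).indicator x ∈ K) :
    (IsWRN K ↔ IsQWRN K) ∧ (IsQWRN K ↔ IsEberlein K) := by
  have : CompactSpace K := isCompact_iff_compactSpace.1 hcomp
  refine ⟨⟨IsWRN.isQWRN, fun hQ => ?_⟩, ⟨fun hQ => ?_, IsEberlein.isQWRN⟩⟩
  · obtain ⟨I, e, 𝓐, φ, h₁, h₂, h₃, h₄, h₅, h₆, h₇⟩ :=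
      hQ.exists_finite_support_family hcomp hsolid
    exact isWRN_of_separating e 𝓐 φ h₁ h₂ h₃ h₄ h₅ h₆ h₇
  · obtain ⟨I, e, 𝓐, φ, -, -, h₃, h₄, h₅, h₆, h₇⟩ :=
      hQ.exists_finite_support_family hcomp hsolid
    refine isEberlein_of_separating e φ h₄ h₅ h₆ fun x n => ?_
    by_contra hS
    obtain ⟨F, hF, hF'⟩ := h₃ _ hS
    exact hF' (h₇ x n F hF)
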